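/- arXiv:0907.1793 — 7 statements merged into one kernel-verified Lean document; each statement's English description precedes it below -/
import Mathlib

section
/- For every n ≥ 2 and every permutation σ of [n], the distance between the linear extensions L_σ and L_σ̄ of the Boolean lattice B_n equals 2^{2n−2} − (n+1)·2^{n−2}. -/
open Finset
open scoped symmDiff

/-- `L` is a linear extension of the partial order on `α`. -/
def IsLinExt {α : Type*} [PartialOrder α] (L : α → α → Prop) : Prop :=
  IsLinearOrder α L ∧ ∀ x y : α, x ≤ y → L x y

/-- The number of unordered pairs of elements appearing in different orders in `L₁` and `L₂`,
counted via the ordered pairs that are strictly below in `L₁` and strictly above in `L₂`. -/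
noncomputable def revCount {α : Type*} (L₁ L₂ : α → α → Prop) : ℕ :=
  Set.ncard {p : α × α | p.1 ≠ p.2 ∧ L₁ p.1 p.2 ∧ L₂ p.2 p.1}

/-- The strict σ-revlex order on subsets of `[n]`: `S < T` iff the σ-largest element of the
symmetric difference `S ∆ T` belongs to `T`. -/
def SigmaRevLexLT {n : ℕ} (σ : Equiv.Perm (Fin n)) (S T : Finset (Fin n)) : Prop :=
  ∃ m ∈ T \ S, ∀ x ∈ S ∆ T, σ.symm x ≤ σ.symm m

/-- The σ-revlex linear extension `L_σ` of the Boolean lattice, as a reflexive relation. -/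
def SigmaRevLex {n : ℕ} (σ : Equiv.Perm (Fin n)) (S T : Finset (Fin n)) : Prop :=
  S = T ∨ SigmaRevLexLT σ S T

/-- The reverse `σ̄` of a permutation `σ` of `[n]`. -/
def revPermOf {n : ℕ} (σ : Equiv.Perm (Fin n)) : Equiv.Perm (Fin n) :=
  (Fin.revPerm : Equiv.Perm (Fin n)).trans σ

/-- An ordered pair `(x,y)` of a poset is a critical pair. -/
def IsCriticalPair {α : Type*} [PartialOrder α] (x y : α) : Prop :=
  ¬ x ≤ y ∧ ¬ y ≤ x ∧ (∀ z, z < x → z < y) ∧ (∀ z, y < z → x < z)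

/-- The downsets of a finite poset, as a poset ordered by inclusion. -/
abbrev DownFinset (α : Type*) [PartialOrder α] : Type _ :=
  {S : Finset α // IsLowerSet (↑S : Set α)}

/-- The strict σ-revlex order on downsets of a poset, for a linear extension `σ`. -/
def DRevLexLT {α : Type*} [PartialOrder α] [DecidableEq α] (σ : α → α → Prop)
    (S T : DownFinset α) : Prop :=
  ∃ m ∈ T.1 \ S.1, ∀ x ∈ S.1 ∆ T.1, σ x m

/-- The σ-revlex linear extension `L_σ` of the downset lattice, as a reflexive relation. -/
def DRevLex {α : Type*} [PartialOrder α] [DecidableEq α] (σ : α → α → Prop)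
    (S T : DownFinset α) : Prop :=
  S = T ∨ DRevLexLT σ S T

/-- The comparability graph of the subposet induced on `D`. -/
def compGraph {α : Type*} [PartialOrder α] (D : Set α) : SimpleGraph D :=
  SimpleGraph.fromRel fun x y => (x : α) ≤ (y : α)

/-- The number of connected components of the subposet induced on `D`. -/
noncomputable def numComponents {α : Type*} [PartialOrder α] (D : Set α) : ℕ :=
  Nat.card (compGraph D).ConnectedComponent

/-- `{σ, τ}` is a realizer of cardinality 2 of the partial order on `α`. -/
def IsRealizer2 {α : Type*} [PartialOrder α] (σ τ : α → α → Prop) : Prop :=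
  IsLinExt σ ∧ IsLinExt τ ∧ ∀ x y : α, x ≤ y ↔ σ x y ∧ τ x y

/-- A linear extension `π` is non-separating. -/
def NonSeparating {α : Type*} [PartialOrder α] (π : α → α → Prop) : Prop :=
  ¬ ∃ u v x : α, u < v ∧ ¬ x ≤ u ∧ ¬ u ≤ x ∧ ¬ x ≤ v ∧ ¬ v ≤ x ∧
      π u x ∧ u ≠ x ∧ π x v ∧ x ≠ v

/-- The principal downset of an element. -/
def pdown {α : Type*} [Fintype α] [PartialOrder α] [DecidableEq α]
    [DecidableRel ((· ≤ ·) : α → α → Prop)] (x : α) : DownFinset α :=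
  ⟨Finset.univ.filter (· ≤ x), by
    intro a b hba ha
    simp only [Finset.mem_coe, Finset.mem_filter] at ha ⊢
    exact ⟨Finset.mem_univ b, hba.trans ha.2⟩⟩

theorem sigmaRevLexLT_iff_of_isMax {n : ℕ} (σ : Equiv.Perm (Fin n)) {S T : Finset (Fin n)}
    {m : Fin n} (hm : m ∈ S ∆ T) (hmax : ∀ x ∈ S ∆ T, σ.symm x ≤ σ.symm m) :
    SigmaRevLexLT σ S T ↔ m ∉ S := by
  constructor
  · rintro ⟨k, hk, hkmax⟩
    have hkD : k ∈ S ∆ T := mem_symmDiff.2 (Or.inr (mem_sdiff.1 hk))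
    have hkm : k = m := σ.symm.injective (le_antisymm (hmax k hkD) (hkmax m hm))
    exact hkm ▸ (mem_sdiff.1 hk).2
  · intro h
    refine ⟨m, ?_, hmax⟩
    simp only [mem_symmDiff, mem_sdiff] at *
    tauto

theorem revPermOf_symm_le_iff {n : ℕ} (σ : Equiv.Perm (Fin n)) (x y : Fin n) :
    (revPermOf σ).symm x ≤ (revPermOf σ).symm y ↔ σ.symm y ≤ σ.symm x := by
  simp [revPermOf]

theorem sigmaRevLexLT_revPermOf_iff_of_isMin {n : ℕ} (σ : Equiv.Perm (Fin n))
    {S T : Finset (Fin n)} {l : Fin n} (hl : l ∈ S ∆ T)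
    (hmin : ∀ x ∈ S ∆ T, σ.symm l ≤ σ.symm x) :
    SigmaRevLexLT (revPermOf σ) T S ↔ l ∈ S := by
  rw [symmDiff_comm] at hl hmin
  rw [sigmaRevLexLT_iff_of_isMax (revPermOf σ) hl
    fun x hx => (revPermOf_symm_le_iff σ x l).2 (hmin x hx)]
  simp only [mem_symmDiff] at hl
  tauto

/-- The pairs strictly increasing for `L_σ` and strictly decreasing for `L_σ̄`. -/
def revLexReversals {n : ℕ} (σ : Equiv.Perm (Fin n)) :
    Set (Finset (Fin n) × Finset (Fin n)) :=
  {p | SigmaRevLexLT σ p.1 p.2 ∧ SigmaRevLexLT (revPermOf σ) p.2 p.1}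

theorem SigmaRevLexLT.ne {n : ℕ} {σ : Equiv.Perm (Fin n)} {S T : Finset (Fin n)}
    (h : SigmaRevLexLT σ S T) : S ≠ T := by
  rintro rfl
  obtain ⟨m, hm, -⟩ := h
  simp at hm

theorem revCount_eq_ncard_revLexReversals {n : ℕ} (σ : Equiv.Perm (Fin n)) :
    revCount (SigmaRevLex σ) (SigmaRevLex (revPermOf σ)) = (revLexReversals σ).ncard := by
  unfold revCount revLexReversals SigmaRevLex
  congr 1
  ext ⟨S, T⟩
  constructor
  · rintro ⟨hne, h₁, h₂⟩
    exact ⟨h₁.resolve_left hne, h₂.resolve_left (Ne.symm hne)⟩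
  · rintro ⟨h₁, h₂⟩
    exact ⟨h₁.ne, Or.inr h₁, Or.inr h₂⟩

theorem one_lt_card_symmDiff_of_mem_revLexReversals {n : ℕ} {σ : Equiv.Perm (Fin n)}
    {p : Finset (Fin n) × Finset (Fin n)} (hp : p ∈ revLexReversals σ) :
    1 < (p.1 ∆ p.2).card := by
  obtain ⟨⟨m, hm, -⟩, ⟨l, hl, -⟩⟩ := hp
  rw [mem_sdiff] at hm hl
  refine one_lt_card.2 ⟨m, mem_symmDiff.2 (Or.inr hm), l, mem_symmDiff.2 (Or.inl hl), ?_⟩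
  rintro rfl
  exact hm.2 hl.1

open scoped Classical in
theorem card_revLexReversals_symmDiff_eq {n : ℕ} (σ : Equiv.Perm (Fin n))
    {D : Finset (Fin n)} (hD : 1 < D.card) :
    #{p : Finset (Fin n) × Finset (Fin n) | p ∈ revLexReversals σ ∧ p.1 ∆ p.2 = D} =
      2 ^ (n - 2) := by
  have hne : D.Nonempty := card_pos.1 (by omega)
  obtain ⟨m, hm, hmax⟩ := exists_max_image D σ.symm hne
  obtain ⟨l, hl, hmin⟩ := exists_min_image D σ.symm hne
  have hlm : l ≠ m := by
    rintro rfl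
    obtain ⟨x, hx, hxl⟩ := exists_mem_ne hD l
    exact hxl (σ.symm.injective (le_antisymm (hmax x hx) (hmin x hx)))
  have hcard : #(Icc {l} ({m}ᶜ : Finset (Fin n))) = 2 ^ (n - 2) := by
    rw [card_Icc_finset (by simpa using hlm.symm), card_compl]
    simp [Nat.sub_sub]
  rw [← hcard]
  have hmem (S T : Finset (Fin n)) (h : S ∆ T = D) :
      (S, T) ∈ revLexReversals σ ↔ m ∉ S ∧ l ∈ S := by
    subst h
    exact and_congr (sigmaRevLexLT_iff_of_isMax σ hm hmax)
      (sigmaRevLexLT_revPermOf_iff_of_isMin σ hl hmin)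
  refine card_nbij' Prod.fst (fun S => (S, S ∆ D)) ?_ ?_ ?_ ?_
  · rintro ⟨S, T⟩ h
    simp only [coe_filter, mem_univ, true_and, Set.mem_ofPred_eq] at h
    have := (hmem S T h.2).1 h.1
    simpa [subset_compl_singleton, and_comm] using this
  · intro S hS
    have h : l ∈ S ∧ m ∉ S := by simpa [subset_compl_singleton] using hS
    simp [hmem S (S ∆ D) (symmDiff_symmDiff_cancel_left S D), h]
  · rintro ⟨S, T⟩ h
    simp only [coe_filter, mem_univ, true_and, Set.mem_ofPred_eq] at h
    simp [← h.2]
  · intro S _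
    rfl

theorem Finset.card_filter_one_lt_card (α : Type*) [Fintype α] [DecidableEq α] :
    #{D : Finset α | 1 < D.card} = 2 ^ Fintype.card α - (Fintype.card α + 1) := by
  have h : ({D : Finset α | ¬ 1 < D.card} : Finset (Finset α)) =
      powersetCard 0 univ ∪ powersetCard 1 univ := by
    ext D
    simp only [mem_filter, mem_univ, true_and, mem_union, mem_powersetCard_univ]
    omega
  have hle : #{D : Finset α | ¬ 1 < D.card} = Fintype.card α + 1 := by
    rw [h, card_union_of_disjoint (pairwise_disjoint_powersetCard univ zero_ne_one)]
    simp [card_powersetCard, add_comm]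
  have hsum := card_filter_add_card_filter_not (s := (univ : Finset (Finset α)))
    (fun D => 1 < D.card)
  rw [card_univ, Fintype.card_finset] at hsum
  omega

/-- For every `n ≥ 2` and permutation σ of [n], the distance between the linear
extensions `L_σ` and `L_σ̄` of the Boolean lattice equals `2^(2n-2) - (n+1) * 2^(n-2)`. -/
theorem distance_revlex_pair (n : ℕ) (hn : 2 ≤ n) (σ : Equiv.Perm (Fin n)) :
    revCount (SigmaRevLex σ) (SigmaRevLex (revPermOf σ)) =
      2 ^ (2 * n - 2) - (n + 1) * 2 ^ (n - 2) := by
  classical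
  rw [revCount_eq_ncard_revLexReversals, Set.ncard_eq_toFinset_card',
    card_eq_sum_card_fiberwise (f := fun p => p.1 ∆ p.2)
      (t := ({D | 1 < D.card} : Finset (Finset (Fin n))))]
  · have hfiber (D : Finset (Fin n)) (hD : D ∈ ({D | 1 < D.card} : Finset (Finset (Fin n)))) :
        #{p ∈ (revLexReversals σ).toFinset | p.1 ∆ p.2 = D} = 2 ^ (n - 2) := by
      rw [← card_revLexReversals_symmDiff_eq σ (mem_filter.1 hD).2]
      congr 1
      ext p
      simp
    rw [sum_congr rfl hfiber, sum_const, card_filter_one_lt_card, Fintype.card_fin, smul_eq_mul,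
      Nat.sub_mul, ← pow_add]
    congr 2
    omega
  · intro p hp
    simpa using one_lt_card_symmDiff_of_mem_revLexReversals (by simpa using hp)
end

section
/- Let F₁ and F₂ be families of subsets of [d] such that each F_i is closed under taking subsets and, for each i ∈ {1,2} and every X ⊆ [d], exactly one of X and its complement [d] \ X belongs to F_i. Then |F₁ △ F₂| ≤ 2^{d−1}. -/
open Finset
open scoped symmDiff

/-- A family containing exactly one set of each complementary pair has half of all sets. -/
theorem two_mul_card_of_mem_iff_compl_notMem {α : Type*} [Fintype α] [DecidableEq α]
    {A : Finset (Finset α)} (h : ∀ X, X ∈ A ↔ Xᶜ ∉ A) :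
    2 * #A = 2 ^ Fintype.card α := by
  have hc : #A = #Aᶜ := by
    refine Finset.card_bij' (fun X _ => Xᶜ) (fun X _ => Xᶜ) ?_ ?_ ?_ ?_
    · intro X hX
      exact mem_compl.2 ((h X).1 hX)
    · intro X hX
      rw [h, compl_compl]
      exact mem_compl.1 hX
    · simp
    · simp
  have := card_add_card_compl A
  rw [Fintype.card_finset] at this
  omega

/-- If `F₁`, `F₂` are downward-closed families of subsets of `[d]` such that for each
`i` and every `X` exactly one of `X`, `Xᶜ` lies in `F_i`, then `|F₁ ∆ F₂| ≤ 2^(d-1)`. -/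
theorem symmdiff_of_downclosed_families (d : ℕ) (F₁ F₂ : Set (Finset (Fin d)))
    (h₁down : ∀ X ∈ F₁, ∀ Y : Finset (Fin d), Y ⊆ X → Y ∈ F₁)
    (h₂down : ∀ X ∈ F₂, ∀ Y : Finset (Fin d), Y ⊆ X → Y ∈ F₂)
    (h₁compl : ∀ X : Finset (Fin d), X ∈ F₁ ↔ Xᶜ ∉ F₁)
    (h₂compl : ∀ X : Finset (Fin d), X ∈ F₂ ↔ Xᶜ ∉ F₂) :
    (F₁ ∆ F₂).ncard ≤ 2 ^ (d - 1) := by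
  classical
  obtain ⟨A, rfl⟩ := F₁.toFinite.exists_finset_coe
  obtain ⟨B, rfl⟩ := F₂.toFinite.exists_finset_coe
  have hA : 2 * #A = 2 ^ d := by
    simpa using two_mul_card_of_mem_iff_compl_notMem (A := A) (by simpa using h₁compl)
  have hB : 2 * #B = 2 ^ d := by
    simpa using two_mul_card_of_mem_iff_compl_notMem (A := B) (by simpa using h₂compl)
  have hAB : #A * #B ≤ 2 ^ d * #(A ∩ B) := by
    simpa using IsLowerSet.le_card_inter_finset
      (fun X Y hYX hX => h₁down X hX Y hYX : IsLowerSet (A : Set (Finset (Fin d))))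
      (fun X Y hYX hX => h₂down X hX Y hYX : IsLowerSet (B : Set (Finset (Fin d))))
  rw [← Finset.coe_symmDiff, Set.ncard_coe_finset]
  have hΔ : #(A ∆ B) = #(A \ B) + #(B \ A) :=
    card_union_of_disjoint disjoint_sdiff_sdiff
  have hA' := card_sdiff_add_card_inter A B
  have hB' := card_sdiff_add_card_inter B A
  rw [inter_comm] at hB'
  cases d with
  | zero => omega
  | succ n =>
    rw [pow_succ] at hA hB hAB
    have hpos : 0 < 2 ^ n := by positivity
    have hA2 : #A = 2 ^ n := by omega
    have hB2 : #B = 2 ^ n := by omega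
    have hle : 2 ^ n ≤ 2 * #(A ∩ B) := by
      rw [hA2, hB2, mul_assoc] at hAB
      exact Nat.le_of_mul_le_mul_left hAB hpos
    rw [Nat.add_sub_cancel]
    omega
end

section
/- For every n ≥ 2, the linear extension diameter of the Boolean lattice B_n equals 2^{2n−2} − (n+1)·2^{n−2}. -/
open Finset
open scoped symmDiff

section LinExt

variable {α : Type*} [DecidableEq α]

open Classical in
/-- The subsets `S` of `D` such that `C ∪ S` precedes `C ∪ (D \ S)` in the order `L`. -/
noncomputable def lowerHalf (L : Finset α → Finset α → Prop) (C D : Finset α) :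
    Finset (Finset α) :=
  {S ∈ D.powerset | L (C ∪ S) (C ∪ (D \ S))}

theorem mem_lowerHalf {L : Finset α → Finset α → Prop} {C D S : Finset α} :
    S ∈ lowerHalf L C D ↔ S ⊆ D ∧ L (C ∪ S) (C ∪ (D \ S)) := by
  simp [lowerHalf]

theorem IsLinExt.isLowerSet_lowerHalf {L : Finset α → Finset α → Prop} (hL : IsLinExt L)
    (C D : Finset α) : IsLowerSet (lowerHalf L C D : Set (Finset α)) := by
  have := hL.1
  intro S T hTS hS
  rw [mem_coe, mem_lowerHalf] at hS ⊢
  refine ⟨hTS.trans hS.1, _root_.trans (hL.2 _ _ ?_) (_root_.trans hS.2 (hL.2 _ _ ?_))⟩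
  · exact union_subset_union_right hTS
  · exact union_subset_union_right (sdiff_subset_sdiff subset_rfl hTS)

theorem union_ne_union_sdiff {C D : Finset α} (hD : D.Nonempty) (hCD : Disjoint C D)
    (S : Finset α) : C ∪ S ≠ C ∪ (D \ S) := by
  obtain ⟨x, hx⟩ := hD
  have hxC : x ∉ C := fun h => disjoint_left.1 hCD h hx
  intro h
  have := congrArg (x ∈ ·) h
  simp [hx, hxC] at this

theorem IsLinExt.not_iff_swap {β : Type*} [PartialOrder β] {L : β → β → Prop}
    (hL : IsLinExt L) {x y : β} (hxy : x ≠ y) : ¬ L x y ↔ L y x := by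
  have := hL.1
  exact ⟨fun h => (total_of L x y).resolve_left h, fun h h' => hxy (antisymm_of L h' h)⟩

theorem IsLinExt.two_mul_card_lowerHalf {L : Finset α → Finset α → Prop} (hL : IsLinExt L)
    {C D : Finset α} (hD : D.Nonempty) (hCD : Disjoint C D) :
    2 * #(lowerHalf L C D) = 2 ^ #D := by
  classical
  have hcompl : #(lowerHalf L C D) = #(D.powerset \ lowerHalf L C D) := by
    refine card_nbij' (D \ ·) (D \ ·) ?_ ?_ ?_ ?_
    · intro S hS
      rw [mem_coe, mem_lowerHalf] at hS
      have hne := union_ne_union_sdiff hD hCD S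
      simp only [mem_coe, mem_sdiff, mem_powerset, mem_lowerHalf, sdiff_subset, true_and,
        _root_.sdiff_sdiff_eq_self hS.1]
      exact (hL.not_iff_swap hne.symm).2 hS.2
    · intro S hS
      simp only [mem_coe, mem_sdiff, mem_powerset, mem_lowerHalf, not_and] at hS
      have hne := union_ne_union_sdiff hD hCD S
      simp only [mem_coe, mem_lowerHalf, sdiff_subset, true_and, _root_.sdiff_sdiff_eq_self hS.1]
      exact (hL.not_iff_swap hne).1 (hS.2 hS.1)
    · intro S hS
      exact _root_.sdiff_sdiff_eq_self (mem_lowerHalf.1 hS).1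
    · intro S hS
      exact _root_.sdiff_sdiff_eq_self (mem_powerset.1 (mem_sdiff.1 hS).1)
  have hsub : lowerHalf L C D ⊆ D.powerset := fun S hS => mem_powerset.2 (mem_lowerHalf.1 hS).1
  have := card_sdiff_add_card_eq_card hsub
  rw [card_powerset] at this
  omega

/-- By the Harris–Kleitman inequality, at most a quarter of the subsets of `D` lie in one lower
half but not in another. -/
theorem four_mul_card_lowerHalf_sdiff_le {L₁ L₂ : Finset α → Finset α → Prop}
    (h₁ : IsLinExt L₁) (h₂ : IsLinExt L₂) {C D : Finset α} (hD : D.Nonempty)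
    (hCD : Disjoint C D) :
    4 * #(lowerHalf L₁ C D \ lowerHalf L₂ C D) ≤ 2 ^ #D := by
  have hle := (h₁.isLowerSet_lowerHalf C D).le_card_inter_finset' (h₂.isLowerSet_lowerHalf C D)
    (fun S hS => (mem_lowerHalf.1 hS).1) (fun S hS => (mem_lowerHalf.1 hS).1)
  have e₁ := h₁.two_mul_card_lowerHalf hD hCD
  have e₂ := h₂.two_mul_card_lowerHalf hD hCD
  have hsplit := card_sdiff_add_card_inter (lowerHalf L₁ C D) (lowerHalf L₂ C D)
  have hpos : 0 < 2 ^ #D := by positivity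
  rw [← e₁] at hpos hle ⊢
  have : #(lowerHalf L₁ C D) = #(lowerHalf L₂ C D) := by omega
  rw [← this] at hle
  have : #(lowerHalf L₁ C D) ≤ 2 * #(lowerHalf L₁ C D ∩ lowerHalf L₂ C D) :=
    le_of_mul_le_mul_left (by linarith) (show 0 < #(lowerHalf L₁ C D) by omega)
  omega

theorem IsLinExt.card_symmDiff_of_reversed {L₁ L₂ : Finset α → Finset α → Prop}
    (h₁ : IsLinExt L₁) (h₂ : IsLinExt L₂) {A B : Finset α} (hne : A ≠ B)
    (hAB : L₁ A B) (hBA : L₂ B A) : 2 ≤ #(A ∆ B) := by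
  have hA : (A \ B).Nonempty := by
    rw [sdiff_nonempty]
    exact fun h => (h₂.not_iff_swap hne.symm).2 (h₂.2 _ _ h) hBA
  have hB : (B \ A).Nonempty := by
    rw [sdiff_nonempty]
    exact fun h => (h₁.not_iff_swap hne).2 (h₁.2 _ _ h) hAB
  have hcard : #(A ∆ B) = #(A \ B) + #(B \ A) := card_union_of_disjoint disjoint_sdiff_sdiff
  have := hA.card_pos
  have := hB.card_pos
  omega

theorem card_filter_two_le_card [Fintype α] :
    #{D : Finset α | 2 ≤ #D} + (Fintype.card α + 1) = 2 ^ Fintype.card α := by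
  have hsmall : ({D : Finset α | ¬ 2 ≤ #D} : Finset (Finset α)) =
      powersetCard 0 univ ∪ powersetCard 1 univ := by
    ext D
    simp only [mem_filter, mem_univ, true_and, mem_union, mem_powersetCard, subset_univ]
    omega
  have hcard : #{D : Finset α | ¬ 2 ≤ #D} = Fintype.card α + 1 := by
    rw [hsmall, card_union_of_disjoint, card_powersetCard, card_powersetCard, card_univ]
    · simp [add_comm]
    · exact pairwise_disjoint_powersetCard univ zero_ne_one
  rw [← hcard, card_filter_add_card_filter_not, card_univ, Fintype.card_finset]

theorem four_mul_revCount_le [Fintype α] {L₁ L₂ : Finset α → Finset α → Prop}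
    (h₁ : IsLinExt L₁) (h₂ : IsLinExt L₂) :
    4 * revCount L₁ L₂ ≤ #{D : Finset α | 2 ≤ #D} * 2 ^ Fintype.card α := by
  classical
  have hcount : revCount L₁ L₂ ≤ #(({D : Finset α | 2 ≤ #D} : Finset (Finset α)).sigma fun D =>
      Dᶜ.powerset.sigma fun C => lowerHalf L₁ C D \ lowerHalf L₂ C D) := by
    rw [revCount, ← Set.ncard_coe_finset]
    refine Set.ncard_le_ncard_of_injOn
      (fun p => ⟨p.1 ∆ p.2, ⟨p.1 \ (p.1 ∆ p.2), p.1 ∩ (p.1 ∆ p.2)⟩⟩) ?_ ?_ (finite_toSet _)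
    · rintro ⟨A, B⟩ ⟨hne, hAB, hBA⟩
      have eA : A \ (A ∆ B) ∪ A ∩ (A ∆ B) = A := sdiff_union_inter A _
      have eB : A \ (A ∆ B) ∪ (A ∆ B) \ (A ∩ (A ∆ B)) = B := by
        ext x
        simp only [mem_union, mem_sdiff, mem_inter, mem_symmDiff]
        tauto
      simp only [mem_coe, mem_sigma, mem_filter, mem_univ, true_and, mem_powerset, mem_sdiff,
        mem_lowerHalf, inter_subset_right, eA, eB]
      refine ⟨h₁.card_symmDiff_of_reversed h₂ hne hAB hBA, ?_, hAB,
        (h₂.not_iff_swap hne).2 hBA⟩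
      exact fun x hx => mem_compl.2 (mem_sdiff.1 hx).2
    · rintro ⟨A, B⟩ - ⟨A', B'⟩ - h
      simp only [Sigma.mk.injEq, heq_eq_eq] at h
      obtain ⟨hD, hC, hS⟩ := h
      have hA : A = A' := by
        rw [← sdiff_union_inter A (A ∆ B), hC, hS, sdiff_union_inter]
      subst hA
      rw [symmDiff_right_injective A hD]
  refine (Nat.mul_le_mul_left 4 hcount).trans ?_
  rw [card_sigma, mul_sum, ← smul_eq_mul (#_), ← sum_const]
  refine sum_le_sum fun D hD => ?_
  have hD' : D.Nonempty := card_pos.1 (by have := (mem_filter.1 hD).2; omega)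
  calc 4 * #(Dᶜ.powerset.sigma fun C => lowerHalf L₁ C D \ lowerHalf L₂ C D)
      ≤ ∑ C ∈ Dᶜ.powerset, 2 ^ #D := by
        rw [card_sigma, mul_sum]
        refine sum_le_sum fun C hC => four_mul_card_lowerHalf_sdiff_le h₁ h₂ hD' ?_
        exact disjoint_left.2 fun x hx => mem_compl.1 (mem_powerset.1 hC hx)
    _ = 2 ^ Fintype.card α := by
        rw [sum_const, card_powerset, smul_eq_mul, ← pow_add, card_compl_add_card]

theorem isLinExt_of_monotone_injective {β γ : Type*} [PartialOrder β] [LinearOrder γ]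
    {f : β → γ} (hf : Monotone f) (hinj : Function.Injective f) :
    IsLinExt fun x y => f x ≤ f y :=
  ⟨{ refl := fun _ => le_rfl
     trans := fun _ _ _ => le_trans
     antisymm := fun _ _ h h' => hinj (le_antisymm h h')
     total := fun _ _ => le_total _ _ }, fun _ _ h => hf h⟩

end LinExt

/-- The colexicographic order and the colexicographic order for the reversed ground set reverse
at least a quarter of the ordered pairs with a given symmetric difference of size at least two. -/
theorem exists_isLinExt_le_revCount (α : Type*) [Fintype α] [LinearOrder α] :
    ∃ L₁ L₂ : Finset α → Finset α → Prop, IsLinExt L₁ ∧ IsLinExt L₂ ∧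
      #{D : Finset α | 2 ≤ #D} * 2 ^ (Fintype.card α - 2) ≤ revCount L₁ L₂ := by
  classical
  let e : α ↪ αᵒᵈ := OrderDual.toDual.toEmbedding
  refine ⟨fun A B => toColex A ≤ toColex B, fun A B => toColex (A.map e) ≤ toColex (B.map e),
    isLinExt_of_monotone_injective Finset.Colex.toColex_mono toColex.injective,
    isLinExt_of_monotone_injective
      (fun A B h => Finset.Colex.toColex_mono (map_subset_map.2 h))
      (toColex.injective.comp (map_injective e)), ?_⟩
  have hsum : #{D : Finset α | 2 ≤ #D} * 2 ^ (Fintype.card α - 2) ≤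
      #(({D : Finset α | 2 ≤ #D} : Finset (Finset α)).sigma fun D =>
        ({A | (∃ a ∈ D, a ∈ A ∧ ∀ x ∈ D, a ≤ x) ∧ ∃ b ∈ D, b ∉ A ∧ ∀ x ∈ D, x ≤ b} :
          Finset (Finset α))) := by
    rw [card_sigma, ← smul_eq_mul, ← sum_const]
    refine sum_le_sum fun D hD => ?_
    have hD₂ : 1 < #D := (mem_filter.1 hD).2
    have hD' : D.Nonempty := card_pos.1 (by omega)
    have hlt := min'_lt_max'_of_card D hD₂
    have hsub : ({D.min' hD'} : Finset α) ⊆ {D.max' hD'}ᶜ := by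
      simpa using hlt.ne'
    calc 2 ^ (Fintype.card α - 2) = #(Icc {D.min' hD'} {D.max' hD'}ᶜ) := by
          rw [card_Icc_finset hsub, card_compl, card_singleton, card_singleton, Nat.sub_sub]
      _ ≤ _ := card_le_card fun A hA => by
          rw [mem_Icc, singleton_subset_iff,
            subset_compl_singleton] at hA
          simp only [mem_filter, mem_univ, true_and]
          exact ⟨⟨_, D.min'_mem hD', hA.1, fun x => D.min'_le x⟩,
            ⟨_, D.max'_mem hD', hA.2, fun x => D.le_max' x⟩⟩
  refine hsum.trans ?_
  rw [revCount, ← Set.ncard_coe_finset]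
  refine Set.ncard_le_ncard_of_injOn (fun q => (q.2, q.2 ∆ q.1)) ?_ ?_ (Set.toFinite _)
  · rintro ⟨D, A⟩ hq
    simp only [mem_coe, mem_sigma, mem_filter, mem_univ, true_and] at hq
    obtain ⟨-, ⟨a, haD, haA, ha⟩, b, hbD, hbA, hb⟩ := hq
    refine ⟨fun h => ?_, ?_, ?_⟩
    · have := congrArg (a ∈ ·) h
      simp [mem_symmDiff, haA, haD] at this
    · rw [Finset.Colex.toColex_le_toColex]
      intro x hxA hx
      refine ⟨b, ?_, hbA, hb x ?_⟩
      · simp [mem_symmDiff, hbD, hbA]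
      · simpa [mem_symmDiff, hxA] using hx
    · rw [Finset.Colex.toColex_le_toColex]
      simp only [mem_map]
      rintro - ⟨x, hx, rfl⟩ hxA
      have hxA' : x ∉ A := fun h => hxA ⟨x, h, rfl⟩
      have hxD : x ∈ D := by simpa [mem_symmDiff, hxA'] using hx
      refine ⟨e a, ⟨a, haA, rfl⟩, ?_, ha x hxD⟩
      rintro ⟨y, hy, hya⟩
      rw [e.injective hya] at hy
      simp [mem_symmDiff, haA, haD] at hy
  · rintro ⟨D, A⟩ - ⟨D', A'⟩ - h
    simp only [Prod.mk.injEq] at h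
    obtain ⟨rfl, h⟩ := h
    rw [symmDiff_right_injective A h]

/-- For every `n ≥ 2`, the linear extension diameter of the Boolean lattice `B_n`
equals `2^(2n-2) - (n+1) * 2^(n-2)`. -/
theorem led_boolean_lattice (n : ℕ) (hn : 2 ≤ n) :
    IsGreatest {d : ℕ | ∃ L₁ L₂ : Finset (Fin n) → Finset (Fin n) → Prop,
        IsLinExt L₁ ∧ IsLinExt L₂ ∧ d = revCount L₁ L₂}
      (2 ^ (2 * n - 2) - (n + 1) * 2 ^ (n - 2)) := by
  have hcard := card_filter_two_le_card (α := Fin n)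
  rw [Fintype.card_fin] at hcard
  have hvalue : 2 ^ (2 * n - 2) - (n + 1) * 2 ^ (n - 2) =
      #{D : Finset (Fin n) | 2 ≤ #D} * 2 ^ (n - 2) := by
    rw [show 2 * n - 2 = n + (n - 2) by omega, pow_add, ← Nat.sub_mul, ← hcard,
      Nat.add_sub_cancel]
  have hupper : ∀ L₁ L₂ : Finset (Fin n) → Finset (Fin n) → Prop, IsLinExt L₁ → IsLinExt L₂ →
      revCount L₁ L₂ ≤ #{D : Finset (Fin n) | 2 ≤ #D} * 2 ^ (n - 2) := by
    intro L₁ L₂ h₁ h₂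
    have h := four_mul_revCount_le h₁ h₂
    have hpow : 2 ^ n = 4 * 2 ^ (n - 2) := by
      rw [show 4 = 2 ^ 2 by norm_num, ← pow_add, Nat.add_sub_cancel' hn]
    rw [Fintype.card_fin, hpow] at h
    linarith
  rw [hvalue]
  refine ⟨?_, ?_⟩
  · obtain ⟨L₁, L₂, h₁, h₂, h⟩ := exists_isLinExt_le_revCount (Fin n)
    rw [Fintype.card_fin] at h
    exact ⟨L₁, L₂, h₁, h₂, le_antisymm h (hupper L₁ L₂ h₁ h₂)⟩
  · rintro d ⟨L₁, L₂, h₁, h₂, rfl⟩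
    exact hupper L₁ L₂ h₁ h₂
end

section
/- Let L₁, L₂ be any two linear extensions of the Boolean lattice B_n, let D ⊆ [n] with |D| = d ≥ 2, and let I ⊆ [n] \ D. Then the number of unordered pairs {S,T} of subsets of [n] with S △ T = D and S ∩ T = I that appear in different orders in L₁ and L₂ is at most 2^{d−2}. -/
open Finset
open scoped symmDiff

/-- The subset of `D` given by `A`, together with `I`. -/
def unionBase {α : Type*} [DecidableEq α] (D I : Finset α) (A : Finset D) : Finset α :=
  A.map (Function.Embedding.subtype _) ∪ I

section

variable {α : Type*} [DecidableEq α] {D I : Finset α}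

theorem mem_unionBase {A : Finset D} {x : α} :
    x ∈ unionBase D I A ↔ (∃ h : x ∈ D, (⟨x, h⟩ : D) ∈ A) ∨ x ∈ I := by
  simp [unionBase]

theorem unionBase_mono : Monotone (unionBase D I) := fun _ _ h =>
  union_subset_union_left (map_subset_map.2 h)

theorem unionBase_ne_compl (hD : D.Nonempty) (hDI : Disjoint D I) (A : Finset D) :
    unionBase D I A ≠ unionBase D I Aᶜ := by
  obtain ⟨x, hx⟩ := hD
  have hxI : x ∉ I := Finset.disjoint_left.1 hDI hx
  intro h
  have := Finset.ext_iff.1 h x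
  simp [mem_unionBase, hx, hxI] at this

theorem exists_unionBase_of_symmDiff_of_inter {S T : Finset α}
    (hD : S ∆ T = D) (hI : S ∩ T = I) :
    ∃ A : Finset D, unionBase D I A = S ∧ unionBase D I Aᶜ = T := by
  subst hD hI
  refine ⟨univ.filter fun x => (x : α) ∈ S, ?_, ?_⟩ <;>
  · ext x
    simp only [mem_unionBase, mem_compl, mem_filter, mem_univ, true_and, mem_symmDiff, mem_inter]
    grind

/-- A family containing at most one member of each complementary pair fills at most half of the
Boolean lattice. -/
theorem two_mul_card_le_of_compl_notMem {β : Type*} [Fintype β] [DecidableEq β]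
    {𝒜 : Finset (Finset β)} (h : ∀ A ∈ 𝒜, Aᶜ ∉ 𝒜) : 2 * #𝒜 ≤ 2 ^ Fintype.card β := by
  have hdisj : Disjoint 𝒜 (𝒜.image compl) := by
    rw [Finset.disjoint_left]
    intro A hA hA'
    obtain ⟨B, hB, rfl⟩ := mem_image.1 hA'
    exact h B hB hA
  have hcard := card_le_univ (𝒜 ∪ 𝒜.image compl)
  rw [card_union_of_disjoint hdisj, card_image_of_injective _ compl_injective,
    Fintype.card_finset] at hcard
  omega

theorem IsLinExt.antisymm {β : Type*} [PartialOrder β] {L : β → β → Prop} (h : IsLinExt L)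
    {x y : β} (hxy : L x y) (hyx : L y x) : x = y :=
  have := h.1
  antisymm_of L hxy hyx

theorem IsLinExt.of_le_of_le {β : Type*} [PartialOrder β] {L : β → β → Prop} (h : IsLinExt L)
    {x x' y y' : β} (hx : x' ≤ x) (hy : y ≤ y') (hxy : L x y) : L x' y' :=
  have := h.1
  trans_of L (trans_of L (h.2 _ _ hx) hxy) (h.2 _ _ hy)

end

/-- For any two linear extensions `L₁, L₂` of `B_n` and any class `C_{D,I}` with
`|D| = d ≥ 2`, the number of unordered pairs `{S,T}` with `S ∆ T = D`, `S ∩ T = I` appearing in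
different orders in `L₁` and `L₂` is at most `2^(d-2)`. -/
theorem class_contributes_at_most (n : ℕ)
    (L₁ L₂ : Finset (Fin n) → Finset (Fin n) → Prop)
    (h₁ : IsLinExt L₁) (h₂ : IsLinExt L₂)
    (D I : Finset (Fin n)) (hd : 2 ≤ D.card) (hDI : Disjoint D I) :
    Set.ncard {p : Finset (Fin n) × Finset (Fin n) |
        p.1 ∆ p.2 = D ∧ p.1 ∩ p.2 = I ∧ L₁ p.1 p.2 ∧ L₂ p.2 p.1}
      ≤ 2 ^ (D.card - 2) := by
  classical
  have hne : D.Nonempty := card_pos.1 (by omega)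
  let g := unionBase D I
  let 𝒜 : Finset (Finset D) := univ.filter fun A => L₁ (g A) (g Aᶜ)
  let ℬ : Finset (Finset D) := univ.filter fun A => L₂ (g Aᶜ) (g A)
  have h𝒜 : IsLowerSet (𝒜 : Set (Finset D)) := by
    intro A B hBA hA
    simp only [𝒜, coe_filter, mem_univ, true_and, Set.mem_ofPred_eq] at hA ⊢
    exact h₁.of_le_of_le (unionBase_mono hBA) (unionBase_mono (compl_le_compl hBA)) hA
  have hℬ : IsUpperSet (ℬ : Set (Finset D)) := by
    intro A B hAB hA
    simp only [ℬ, coe_filter, mem_univ, true_and, Set.mem_ofPred_eq] at hA ⊢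
    exact h₂.of_le_of_le (unionBase_mono (compl_le_compl hAB)) (unionBase_mono hAB) hA
  have card𝒜 : 2 * #𝒜 ≤ 2 ^ #D := by
    rw [← Fintype.card_coe D]
    refine two_mul_card_le_of_compl_notMem fun A hA hA' => ?_
    simp only [𝒜, mem_filter, mem_univ, true_and, compl_compl] at hA hA'
    exact unionBase_ne_compl hne hDI A (h₁.antisymm hA hA')
  have cardℬ : 2 * #ℬ ≤ 2 ^ #D := by
    rw [← Fintype.card_coe D]
    refine two_mul_card_le_of_compl_notMem fun A hA hA' => ?_
    simp only [ℬ, mem_filter, mem_univ, true_and, compl_compl] at hA hA'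
    exact unionBase_ne_compl hne hDI A (h₂.antisymm hA' hA)
  have hinter : 2 ^ #D * #(𝒜 ∩ ℬ) ≤ #𝒜 * #ℬ := by
    simpa using h𝒜.card_inter_le_finset hℬ
  have hsub : {p : Finset (Fin n) × Finset (Fin n) |
      p.1 ∆ p.2 = D ∧ p.1 ∩ p.2 = I ∧ L₁ p.1 p.2 ∧ L₂ p.2 p.1} ⊆
      ((𝒜 ∩ ℬ).image fun A => (g A, g Aᶜ) : Finset _) := by
    rintro ⟨S, T⟩ ⟨hD, hI, hL₁, hL₂⟩
    obtain ⟨A, rfl, rfl⟩ := exists_unionBase_of_symmDiff_of_inter hD hI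
    exact mem_coe.2 (mem_image.2 ⟨A, by simp [𝒜, ℬ, g, hL₁, hL₂], rfl⟩)
  have hle := (Set.ncard_le_ncard hsub (finite_toSet _)).trans
    ((Set.ncard_coe_finset _).trans_le card_image_le)
  refine hle.trans ?_
  obtain ⟨k, hk⟩ := Nat.exists_eq_add_of_le' hd
  rw [hk] at card𝒜 cardℬ hinter ⊢
  rw [Nat.add_sub_cancel]
  have hpow : 2 ^ (k + 2) = 4 * 2 ^ k := by ring
  rw [hpow] at card𝒜 cardℬ hinter
  have hprod : #𝒜 * #ℬ ≤ (2 * 2 ^ k) * (2 * 2 ^ k) :=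
    Nat.mul_le_mul (by omega) (by omega)
  have hscaled : 4 * 2 ^ k * #(𝒜 ∩ ℬ) ≤ 4 * 2 ^ k * 2 ^ k := by linarith
  exact Nat.le_of_mul_le_mul_left hscaled (by positivity)
end

section
/- Let P be a finite poset, D ⊆ P and I ⊆ P \ D, and suppose there exists at least one ordered pair (A₀,B₀) of antichains of P with A₀ △ B₀ = D and A₀ ∩ B₀ = I. Then the number of ordered pairs (A,B) of antichains of P with A △ B = D and A ∩ B = I equals 2^k, where k is the number of connected components of the induced subposet P[D]. -/
open Finset
open scoped symmDiff

theorem compGraph_adj_of_le {α : Type*} [PartialOrder α] {D : Set α} {x y : D}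
    (hne : x ≠ y) (hle : (x : α) ≤ y) : (compGraph D).Adj x y := by
  exact (SimpleGraph.fromRel_adj _ _ _).2 ⟨hne, Or.inl hle⟩

/-- A predicate that is invariant along edges is constant on connected components. -/
theorem iff_of_reachable_of_adj {V : Type*} {G : SimpleGraph V} {p : V → Prop}
    (hp : ∀ x y, G.Adj x y → (p x ↔ p y)) {x y : V} (h : G.Reachable x y) : p x ↔ p y := by
  obtain ⟨w⟩ := h
  induction w with
  | nil => rfl
  | cons hadj _ ih => exact (hp _ _ hadj).trans ih

/-- If two antichains cover both ends of an edge of the comparability graph of their symmetric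
difference, then exactly one end lies in the first antichain. -/
theorem mem_iff_notMem_of_compGraph_adj {α : Type*} [PartialOrder α] [DecidableEq α]
    {A B D : Finset α} (hA : IsAntichain (· ≤ ·) (↑A : Set α))
    (hB : IsAntichain (· ≤ ·) (↑B : Set α)) (hD : A ∆ B = D) {x y : (↑D : Set α)}
    (h : (compGraph (↑D : Set α)).Adj x y) : (x : α) ∈ A ↔ (y : α) ∉ A := by
  have hx : (x : α) ∈ A ∆ B := hD ▸ x.2
  have hy : (y : α) ∈ A ∆ B := hD ▸ y.2
  rw [Finset.mem_symmDiff] at hx hy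
  simp only [compGraph, SimpleGraph.fromRel_adj] at h
  obtain ⟨hne, hle⟩ := h
  have hne' : (x : α) ≠ y := fun e => hne (Subtype.ext e)
  have key : ∀ C : Finset α, IsAntichain (· ≤ ·) (↑C : Set α) →
      ¬ ((x : α) ∈ C ∧ (y : α) ∈ C) := by
    rintro C hC ⟨hxC, hyC⟩
    rcases hle with hle | hle
    · exact hne' (hC.eq hxC hyC hle)
    · exact hne' (hC.eq hyC hxC hle).symm
  have := key A hA
  have := key B hB
  tauto

/-- A set covered by `A ∪ B`, for antichains `A` and `B`, is an antichain if comparable elements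
of `A ∆ B` in it always lie on the same side. -/
theorem isAntichain_of_same_side {α : Type*} [PartialOrder α] [DecidableEq α]
    {A B C : Finset α} (hA : IsAntichain (· ≤ ·) (↑A : Set α))
    (hB : IsAntichain (· ≤ ·) (↑B : Set α)) (hC : C ⊆ A ∪ B)
    (hside : ∀ x ∈ C, ∀ y ∈ C, x ≠ y → x ≤ y → x ∈ A ∆ B → y ∈ A ∆ B → (x ∈ A ↔ y ∈ A)) :
    IsAntichain (· ≤ ·) (↑C : Set α) := by
  intro x hx y hy hne hle
  have h := hside x hx y hy hne hle
  have hx' := hC hx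
  have hy' := hC hy
  have h₁ : ¬ (x ∈ A ∧ y ∈ A) := fun e => hA e.1 e.2 hne hle
  have h₂ : ¬ (x ∈ B ∧ y ∈ B) := fun e => hB e.1 e.2 hne hle
  simp only [Finset.mem_symmDiff, Finset.mem_union] at h hx' hy'
  tauto

open Classical in
/-- The set consisting of `I` together with those `x ∈ D` whose membership in `A` agrees with the
membership of the component of `x` in `S`. -/
noncomputable def componentSelect {α : Type*} [Fintype α] [PartialOrder α] (D I A : Finset α)
    (S : Set (compGraph (↑D : Set α)).ConnectedComponent) : Finset α :=
  Finset.univ.filter fun x => x ∈ I ∨ ∃ h : x ∈ (↑D : Set α),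
    (x ∈ A ↔ (compGraph (↑D : Set α)).connectedComponentMk ⟨x, h⟩ ∈ S)

theorem mem_componentSelect {α : Type*} [Fintype α] [PartialOrder α] {D I A : Finset α}
    {S : Set (compGraph (↑D : Set α)).ConnectedComponent} {x : α} :
    x ∈ componentSelect D I A S ↔ x ∈ I ∨ ∃ h : x ∈ (↑D : Set α),
      (x ∈ A ↔ (compGraph (↑D : Set α)).connectedComponentMk ⟨x, h⟩ ∈ S) := by
  simp [componentSelect]

theorem isAntichain_componentSelect {α : Type*} [Fintype α] [PartialOrder α] [DecidableEq α]
    {D I A B : Finset α} (hA : IsAntichain (· ≤ ·) (↑A : Set α))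
    (hB : IsAntichain (· ≤ ·) (↑B : Set α)) (hD : A ∆ B = D) (hI : A ∩ B = I)
    (S : Set (compGraph (↑D : Set α)).ConnectedComponent) :
    IsAntichain (· ≤ ·) (↑(componentSelect D I A S) : Set α) := by
  refine isAntichain_of_same_side hA hB ?_ ?_
  · intro x hx
    rw [mem_componentSelect, ← hI] at hx
    rcases hx with hx | ⟨hx, -⟩
    · exact Finset.mem_union_left _ (Finset.mem_inter.1 hx).1
    · rw [← hD, Finset.mem_coe, Finset.mem_symmDiff] at hx
      rw [Finset.mem_union]
      tauto
  · intro x hx y hy hne hle hxD hyD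
    have notMem_I : ∀ z ∈ A ∆ B, z ∉ I := by
      intro z hz hzI
      rw [← hI, Finset.mem_inter] at hzI
      rw [Finset.mem_symmDiff] at hz
      tauto
    obtain ⟨hx', hxS⟩ := (mem_componentSelect.1 hx).resolve_left (notMem_I x hxD)
    obtain ⟨hy', hyS⟩ := (mem_componentSelect.1 hy).resolve_left (notMem_I y hyD)
    have hadj : (compGraph (↑D : Set α)).Adj ⟨x, hx'⟩ ⟨y, hy'⟩ :=
      compGraph_adj_of_le (fun e => hne (congrArg Subtype.val e)) hle
    rw [hxS, hyS, SimpleGraph.ConnectedComponent.sound hadj.reachable]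

theorem componentSelect_injective {α : Type*} [Fintype α] [PartialOrder α]
    {D I : Finset α} (hDI : Disjoint D I) (A : Finset α) :
    Function.Injective (componentSelect D I A) := by
  intro S T h
  ext c
  induction c using SimpleGraph.ConnectedComponent.ind with
  | _ v =>
    obtain ⟨x, hx⟩ := v
    have hxI : x ∉ I := Finset.disjoint_left.1 hDI hx
    have hmem : x ∈ componentSelect D I A S ↔ x ∈ componentSelect D I A T := by rw [h]
    simp only [mem_componentSelect, hxI, false_or, hx, exists_true_left] at hmem
    tauto

theorem symmDiff_componentSelect_compl {α : Type*} [Fintype α] [PartialOrder α] [DecidableEq α]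
    {D I : Finset α} (hDI : Disjoint D I) (A : Finset α)
    (S : Set (compGraph (↑D : Set α)).ConnectedComponent) :
    componentSelect D I A S ∆ componentSelect D I A Sᶜ = D := by
  ext x
  simp only [Finset.mem_symmDiff, mem_componentSelect, Set.mem_compl_iff]
  by_cases hx : x ∈ (↑D : Set α)
  · have hxI : x ∉ I := Finset.disjoint_left.1 hDI hx
    have hxD : x ∈ D := hx
    simp only [hxI, false_or, hx, exists_true_left, hxD, iff_true]
    tauto
  · have hxD : x ∉ D := hx
    simp [hxD]

theorem componentSelect_inter_compl {α : Type*} [Fintype α] [PartialOrder α] [DecidableEq α]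
    (D I A : Finset α) (S : Set (compGraph (↑D : Set α)).ConnectedComponent) :
    componentSelect D I A S ∩ componentSelect D I A Sᶜ = I := by
  ext x
  simp only [Finset.mem_inter, mem_componentSelect, Set.mem_compl_iff]
  by_cases hx : x ∈ (↑D : Set α)
  · simp only [hx, exists_true_left]
    tauto
  · have hxD : x ∉ D := hx
    simp [hxD]

theorem exists_componentSelect_eq {α : Type*} [Fintype α] [PartialOrder α] [DecidableEq α]
    {D I A₀ B₀ A B : Finset α}
    (hA₀ : IsAntichain (· ≤ ·) (↑A₀ : Set α)) (hB₀ : IsAntichain (· ≤ ·) (↑B₀ : Set α))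
    (hD₀ : A₀ ∆ B₀ = D)
    (hA : IsAntichain (· ≤ ·) (↑A : Set α)) (hB : IsAntichain (· ≤ ·) (↑B : Set α))
    (hD : A ∆ B = D) (hI : A ∩ B = I) :
    ∃ S, componentSelect D I A₀ S = A ∧ componentSelect D I A₀ Sᶜ = B := by
  let S : Set (compGraph (↑D : Set α)).ConnectedComponent :=
    {c | ∃ v, (compGraph (↑D : Set α)).connectedComponentMk v = c ∧
      ((v : α) ∈ A₀ ↔ (v : α) ∈ A)}
  have hS : ∀ v, (compGraph (↑D : Set α)).connectedComponentMk v ∈ S ↔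
      ((v : α) ∈ A₀ ↔ (v : α) ∈ A) := by
    refine fun v => ⟨?_, fun h => ⟨v, rfl, h⟩⟩
    rintro ⟨w, hw, h⟩
    refine (iff_of_reachable_of_adj
      (p := fun v : (↑D : Set α) => ((v : α) ∈ A₀ ↔ (v : α) ∈ A)) ?_
      (SimpleGraph.ConnectedComponent.exact hw)).1 h
    intro x y hxy
    have h₀ := mem_iff_notMem_of_compGraph_adj hA₀ hB₀ hD₀ hxy
    have h₁ := mem_iff_notMem_of_compGraph_adj hA hB hD hxy
    tauto
  have hmemD : ∀ x, x ∈ (↑D : Set α) ↔ x ∈ A ∧ x ∉ B ∨ x ∈ B ∧ x ∉ A := fun x => by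
    rw [← hD, Finset.mem_coe, Finset.mem_symmDiff]
  have hmemI : ∀ x, x ∈ I ↔ x ∈ A ∧ x ∈ B := fun x => by rw [← hI, Finset.mem_inter]
  refine ⟨S, ?_, ?_⟩ <;> ext x <;>
    simp only [mem_componentSelect, Set.mem_compl_iff, hS, exists_prop, hmemD, hmemI] <;> tauto

/-- If the class `C_{D,I}` of ordered pairs of antichains is nonempty, its size is
`2^k` where `k` is the number of connected components of the induced subposet `P[D]`. -/
theorem antichain_class_card {α : Type*} [Fintype α] [PartialOrder α] [DecidableEq α]
    (D I : Finset α) (hDI : Disjoint D I)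
    (hex : ∃ A₀ B₀ : Finset α, IsAntichain (· ≤ ·) (↑A₀ : Set α) ∧
      IsAntichain (· ≤ ·) (↑B₀ : Set α) ∧ A₀ ∆ B₀ = D ∧ A₀ ∩ B₀ = I) :
    Set.ncard {p : Finset α × Finset α |
        IsAntichain (· ≤ ·) (↑p.1 : Set α) ∧ IsAntichain (· ≤ ·) (↑p.2 : Set α) ∧
        p.1 ∆ p.2 = D ∧ p.1 ∩ p.2 = I}
      = 2 ^ numComponents (↑D : Set α) := by
  obtain ⟨A₀, B₀, hA₀, hB₀, hD₀, hI₀⟩ := hex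
  let f : Set (compGraph (↑D : Set α)).ConnectedComponent → Finset α × Finset α :=
    fun S => (componentSelect D I A₀ S, componentSelect D I A₀ Sᶜ)
  have hf : Function.Injective f := fun S T h =>
    componentSelect_injective hDI A₀ (congrArg Prod.fst h)
  have hrange : {p : Finset α × Finset α |
      IsAntichain (· ≤ ·) (↑p.1 : Set α) ∧ IsAntichain (· ≤ ·) (↑p.2 : Set α) ∧
      p.1 ∆ p.2 = D ∧ p.1 ∩ p.2 = I} = f '' Set.univ := by
    ext ⟨A, B⟩
    rw [Set.image_univ]
    constructor
    · rintro ⟨hA, hB, hD, hI⟩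
      obtain ⟨S, rfl, rfl⟩ := exists_componentSelect_eq hA₀ hB₀ hD₀ hA hB hD hI
      exact ⟨S, rfl⟩
    · rintro ⟨S, hS⟩
      obtain ⟨rfl, rfl⟩ := Prod.mk.inj hS
      exact ⟨isAntichain_componentSelect hA₀ hB₀ hD₀ hI₀ S,
        isAntichain_componentSelect hA₀ hB₀ hD₀ hI₀ Sᶜ,
        symmDiff_componentSelect_compl hDI A₀ S, componentSelect_inter_compl D I A₀ S⟩
  rw [hrange, Set.ncard_image_of_injective _ hf, Set.ncard_univ, numComponents]
  classical
  have : Fintype (compGraph (↑D : Set α)).ConnectedComponent := Fintype.ofFinite _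
  rw [Nat.card_eq_fintype_card, Nat.card_eq_fintype_card, Fintype.card_set]
end

section
/- Let P be a finite poset and D_P its downset lattice. Then 4·led(D_P) is at most the number of ordered pairs (A,B) of antichains of P such that the induced subposet P[A △ B] has at least two connected components. -/
open Finset
open scoped symmDiff

section Lattice

variable {L : Type*} [DistribLattice L] [Fintype L] [DecidableEq L]

open scoped Classical in
/-- Two linear extensions of a distributive lattice reverse at most a quarter of the ordered pairs
with a prescribed infimum and a prescribed supremum. -/
lemma four_mul_card_reversals_fiber_le (R₁ R₂ : L → L → Prop)
    (h₁ : IsLinearOrder L R₁) (h₂ : IsLinearOrder L R₂)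
    (mono₁ : ∀ x y, x ≤ y → R₁ x y) (mono₂ : ∀ x y, x ≤ y → R₂ x y) (I U : L) :
    4 * #{p : L × L | (p.1 ≠ p.2 ∧ R₁ p.1 p.2 ∧ R₂ p.2 p.1) ∧ p.1 ⊓ p.2 = I ∧ p.1 ⊔ p.2 = U} ≤
      #{p : L × L | p.1 ⊓ p.2 = I ∧ p.1 ⊔ p.2 = U} := by
  obtain hIU | hIU := eq_or_ne I U
  · rw [(filter_eq_empty_iff (s := univ)).2, card_empty]
    · exact Nat.zero_le _
    rintro ⟨x, y⟩ - ⟨⟨hne, -⟩, h, h'⟩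
    simp only at h h' hne
    exact hne (inf_eq_sup.1 (h.trans (hIU.trans h'.symm)))
  let C : Finset (L × L) := {p | p.1 ⊓ p.2 = I ∧ p.1 ⊔ p.2 = U}
  have hC : ∀ p ∈ C, p.1 ≠ p.2 := by
    rintro ⟨x, y⟩ hp h
    obtain rfl : x = y := h
    simp only [C, mem_filter, mem_univ, true_and, inf_idem, sup_idem] at hp
    exact hIU (hp.1.symm.trans hp.2)
  let F (R : L → L → Prop) : Finset (L × L) := {p ∈ C | R p.1 p.2}
  have card_half (R : L → L → Prop) (h : IsLinearOrder L R) : #C = 2 * #(F R) := by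
    have hswap : #{p ∈ C | ¬ R p.1 p.2} = #(F R) := by
      refine card_bij (fun p _ ↦ p.swap) ?_ ?_ ?_
      · rintro ⟨x, y⟩ hp
        simp only [F, C, mem_filter, mem_univ, true_and, Prod.swap] at hp ⊢
        rw [inf_comm, sup_comm]
        exact ⟨hp.1, (h.total x y).resolve_left hp.2⟩
      · rintro p - q - hpq
        exact Prod.swap_injective hpq
      · rintro ⟨x, y⟩ hp
        have hne := hC _ (mem_filter.1 hp).1
        refine ⟨(y, x), ?_, rfl⟩
        simp only [F, C, mem_filter, mem_univ, true_and] at hp ⊢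
        rw [inf_comm, sup_comm]
        exact ⟨hp.1, fun h' ↦ hne (h.antisymm _ _ hp.2 h')⟩
    have := card_filter_add_card_filter_not (s := C) (fun p ↦ R p.1 p.2)
    rw [hswap] at this
    change #(F R) + #(F R) = #C at this
    omega
  have card₁ := card_half R₁ h₁
  have card₂ := card_half R₂ h₂
  have key : #(F R₁) * #(F R₂) ≤ #(F R₁ ∩ F R₂) * #C := by
    let e : L × L ↪ L × Lᵒᵈ := ⟨fun p ↦ (p.1, OrderDual.toDual p.2), fun p q h ↦ h⟩
    have daykin := le_card_infs_mul_card_sups ((F R₁).map e) ((F R₂).map e)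
    rw [card_map, card_map] at daykin
    refine daykin.trans (Nat.mul_le_mul ?_ ?_)
    · rw [← card_map e]
      refine card_le_card fun z hz ↦ ?_
      obtain ⟨a, ha, b, hb, rfl⟩ := mem_infs.1 hz
      obtain ⟨⟨x, y⟩, hp, rfl⟩ := mem_map.1 ha
      obtain ⟨⟨x', y'⟩, hq, rfl⟩ := mem_map.1 hb
      refine mem_map.2 ⟨(x ⊓ x', y ⊔ y'), ?_, rfl⟩
      simp only [F, C, mem_inter, mem_filter, mem_univ, true_and] at hp hq ⊢
      obtain ⟨⟨rfl, rfl⟩, hR⟩ := hp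
      obtain ⟨⟨hI, hU⟩, hR'⟩ := hq
      have hmem : (x ⊓ x') ⊓ (y ⊔ y') = x ⊓ y ∧ (x ⊓ x') ⊔ (y ⊔ y') = x ⊔ y := by
        constructor
        · rw [inf_sup_left]
          refine le_antisymm (sup_le ?_ ?_) (le_sup_of_le_left ?_)
          · exact inf_le_inf_right _ inf_le_left
          · rw [← hI]
            exact inf_le_inf_right _ inf_le_right
          · exact le_inf (le_inf inf_le_left (hI ▸ inf_le_left)) inf_le_right
        · refine le_antisymm ?_ ?_
          · exact sup_le (inf_le_left.trans le_sup_left)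
              (sup_le le_sup_right (hU ▸ le_sup_right))
          · rw [sup_inf_right]
            exact le_inf (sup_le_sup_left le_sup_left _)
              (hU ▸ sup_le_sup_left le_sup_right _)
      exact ⟨⟨hmem, h₁.trans _ _ _ (h₁.trans _ _ _ (mono₁ _ _ inf_le_left) hR)
          (mono₁ _ _ le_sup_left)⟩,
        hmem, h₂.trans _ _ _ (h₂.trans _ _ _ (mono₂ _ _ inf_le_right) hR')
          (mono₂ _ _ le_sup_right)⟩
    · rw [← card_map e]
      refine card_le_card fun z hz ↦ ?_
      obtain ⟨a, ha, b, hb, rfl⟩ := mem_sups.1 hz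
      obtain ⟨⟨x, y⟩, hp, rfl⟩ := mem_map.1 ha
      obtain ⟨⟨x', y'⟩, hq, rfl⟩ := mem_map.1 hb
      refine mem_map.2 ⟨(x ⊔ x', y ⊓ y'), ?_, rfl⟩
      simp only [F, C, mem_filter, mem_univ, true_and] at hp hq ⊢
      obtain ⟨⟨rfl, rfl⟩, -⟩ := hp
      obtain ⟨⟨hI, hU⟩, -⟩ := hq
      constructor
      · refine le_antisymm ?_ ?_
        · rw [inf_sup_right]
          exact sup_le (inf_le_inf_left _ inf_le_left) (hI ▸ inf_le_inf_left _ inf_le_right)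
        · exact le_inf (inf_le_left.trans le_sup_left)
            (le_inf inf_le_right (hI ▸ inf_le_right))
      · refine le_antisymm ?_ ?_
        · exact sup_le (sup_le le_sup_left (hU ▸ le_sup_left)) (inf_le_left.trans le_sup_right)
        · rw [sup_inf_left]
          exact le_inf (sup_le_sup_right le_sup_left _)
            (hU ▸ sup_le_sup_right le_sup_right _)
  have hsub : #{p : L × L | (p.1 ≠ p.2 ∧ R₁ p.1 p.2 ∧ R₂ p.2 p.1) ∧
      p.1 ⊓ p.2 = I ∧ p.1 ⊔ p.2 = U} + #(F R₁ ∩ F R₂) ≤ #(F R₁) := by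
    rw [← card_union_of_disjoint]
    · refine card_le_card (union_subset (fun p hp ↦ ?_) inter_subset_left)
      simp only [F, C, mem_filter, mem_univ, true_and] at hp ⊢
      exact ⟨hp.2, hp.1.2.1⟩
    · refine disjoint_left.2 fun p hp hp' ↦ ?_
      simp only [F, C, mem_filter, mem_univ, true_and, mem_inter] at hp hp'
      exact hp.1.1 (h₂.antisymm _ _ hp'.2.2 hp.1.2.2)
  change 4 * _ ≤ #C
  obtain hpos | hpos := Nat.eq_zero_or_pos #C
  · omega
  · have : #C * #C ≤ (4 * #(F R₁ ∩ F R₂)) * #C := by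
      calc #C * #C = 4 * (#(F R₁) * #(F R₂)) := by nth_rw 1 [card₁]; rw [card₂]; ring
        _ ≤ 4 * (#(F R₁ ∩ F R₂) * #C) := Nat.mul_le_mul_left _ key
        _ = _ := by ring
    have := Nat.le_of_mul_le_mul_right this hpos
    omega

open scoped Classical in
/-- Four times the number of reversals of two linear extensions is at most the number of ordered
pairs satisfying `Q`, if `Q` holds for all incomparable pairs and depends only on the infimum and
the supremum of a pair. -/
lemma four_mul_card_reversals_le (R₁ R₂ : L → L → Prop)
    (h₁ : IsLinearOrder L R₁) (h₂ : IsLinearOrder L R₂)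
    (mono₁ : ∀ x y, x ≤ y → R₁ x y) (mono₂ : ∀ x y, x ≤ y → R₂ x y) (Q : L → L → Prop)
    (incomp : ∀ x y, ¬ x ≤ y → ¬ y ≤ x → Q x y)
    (congr : ∀ x y x' y', x ⊓ y = x' ⊓ y' → x ⊔ y = x' ⊔ y' → Q x y → Q x' y') :
    4 * #{p : L × L | p.1 ≠ p.2 ∧ R₁ p.1 p.2 ∧ R₂ p.2 p.1} ≤ #{p : L × L | Q p.1 p.2} := by
  have hmaps (s : Finset (L × L)) :
      Set.MapsTo (fun p : L × L ↦ (p.1 ⊓ p.2, p.1 ⊔ p.2)) s (univ : Finset (L × L)) :=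
    fun _ _ ↦ mem_coe.2 (mem_univ _)
  rw [card_eq_sum_card_fiberwise (hmaps _), card_eq_sum_card_fiberwise (hmaps {p | Q p.1 p.2}),
    mul_sum]
  refine sum_le_sum fun c _ ↦ ?_
  simp only [filter_filter, Prod.ext_iff]
  obtain hempty | ⟨p, hp⟩ := Finset.eq_empty_or_nonempty
    ({p | (p.1 ≠ p.2 ∧ R₁ p.1 p.2 ∧ R₂ p.2 p.1) ∧ p.1 ⊓ p.2 = c.1 ∧ p.1 ⊔ p.2 = c.2} :
      Finset (L × L))
  · rw [hempty, card_empty]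
    exact Nat.zero_le _
  · refine (four_mul_card_reversals_fiber_le R₁ R₂ h₁ h₂ mono₁ mono₂ c.1 c.2).trans
      (card_le_card fun q hq ↦ ?_)
    simp only [mem_filter, mem_univ, true_and] at hp hq ⊢
    obtain ⟨⟨hne, hp₁, hp₂⟩, hinf, hsup⟩ := hp
    refine ⟨congr p.1 p.2 _ _ (hinf.trans hq.1.symm) (hsup.trans hq.2.symm) ?_, hq⟩
    exact incomp _ _ (fun h ↦ hne (h₂.antisymm _ _ (mono₂ _ _ h) hp₂))
      (fun h ↦ hne (h₁.antisymm _ _ hp₁ (mono₁ _ _ h)))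

end Lattice

section Components

variable {α : Type*} [PartialOrder α]

lemma two_le_numComponents_iff [Finite α] {D : Set α} :
    2 ≤ numComponents D ↔ ¬ (compGraph D).Preconnected := by
  rw [numComponents, Nat.succ_le_iff, ← not_le, Finite.card_le_one_iff_subsingleton, not_iff_not]
  refine ⟨fun h x y ↦ ?_, fun h ↦ h.subsingleton_connectedComponent⟩
  exact SimpleGraph.ConnectedComponent.eq.1 (Subsingleton.elim _ _)

lemma compGraph_reachable_of_le {D : Set α} {x y : D} (h : (x : α) ≤ y) :
    (compGraph D).Reachable x y := by
  obtain rfl | hne := eq_or_ne x y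
  · exact .rfl
  · exact SimpleGraph.Adj.reachable ((SimpleGraph.fromRel_adj _ _ _).2 ⟨hne, .inl h⟩)

/-- Removing elements that are not minimal does not merge components. -/
lemma compGraph_preconnected_of_subset {C D : Set α} (hDC : D ⊆ C)
    (hmin : ∀ x ∈ C, ∃ d ∈ D, d ≤ x) (h : (compGraph D).Preconnected) :
    (compGraph C).Preconnected := by
  intro x y
  obtain ⟨d, hd, hdx⟩ := hmin x x.2
  obtain ⟨e, he, hey⟩ := hmin y y.2
  let f : compGraph D →g compGraph C :=
    { toFun := Set.inclusion hDC
      map_rel' := fun {a b} hab ↦ by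
        rw [compGraph, SimpleGraph.fromRel_adj] at hab ⊢
        exact ⟨fun hab' ↦ hab.1 (Set.inclusion_injective hDC hab'), hab.2⟩ }
  have hde : (compGraph C).Reachable ⟨d, hDC hd⟩ ⟨e, hDC he⟩ := (h ⟨d, hd⟩ ⟨e, he⟩).map f
  exact (compGraph_reachable_of_le hdx).symm.trans (hde.trans (compGraph_reachable_of_le hey))

lemma not_le_of_mem_sdiff [DecidableEq α] {S T : Finset α} (hT : IsLowerSet (T : Set α)) {x y : α}
    (hx : x ∈ S \ T) (hy : y ∈ T \ S) : ¬ x ≤ y :=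
  fun h ↦ (mem_sdiff.1 hx).2 (hT h (mem_sdiff.1 hy).1)

lemma compGraph_symmDiff_not_preconnected [DecidableEq α] {S T : Finset α}
    (hS : IsLowerSet (S : Set α)) (hT : IsLowerSet (T : Set α)) (hST : ¬ S ⊆ T) (hTS : ¬ T ⊆ S) :
    ¬ (compGraph (↑(S ∆ T) : Set α)).Preconnected := by
  intro h
  obtain ⟨x, hxS, hxT⟩ := not_subset.1 hST
  obtain ⟨y, hyT, hyS⟩ := not_subset.1 hTS
  have hx : x ∈ (↑(S ∆ T) : Set α) := mem_coe.2 (mem_symmDiff.2 (.inl ⟨hxS, hxT⟩))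
  have hy : y ∈ (↑(S ∆ T) : Set α) := mem_coe.2 (mem_symmDiff.2 (.inr ⟨hyT, hyS⟩))
  have step : ∀ a b, (compGraph (↑(S ∆ T) : Set α)).Adj a b → (a : α) ∈ S → (b : α) ∈ S := by
    rintro ⟨a, ha⟩ ⟨b, hb⟩ hab haS
    rw [compGraph, SimpleGraph.fromRel_adj] at hab
    rw [mem_coe, mem_symmDiff] at ha hb
    obtain hab | hba := hab.2
    · by_contra hbS
      have haT : a ∈ T := hT hab (hb.resolve_left fun h ↦ hbS h.1).1
      exact (ha.resolve_right fun h ↦ h.2 haS).2 haT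
    · exact hS hba haS
  obtain ⟨w⟩ := h ⟨x, hx⟩ ⟨y, hy⟩
  have walk : ∀ a b, (compGraph (↑(S ∆ T) : Set α)).Walk a b → (a : α) ∈ S → (b : α) ∈ S := by
    intro a b w
    induction w with
    | nil => exact id
    | cons hadj _ ih => exact fun ha ↦ ih (step _ _ hadj ha)
  exact hyS (walk _ _ w hxS)

end Components

section Antichain

variable {α : Type*} [PartialOrder α] [Fintype α] [DecidableEq α]

open scoped Classical in
/-- The first entry of the pair of antichains assigned to a pair `(S, T)` of downsets: the maximal
elements of the part of `S ∩ T` not below `S ∆ T`, the maximal elements of `S \ T`, and the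
minimal but not maximal elements of `T \ S`. -/
noncomputable def antichainOfPair (S T : Finset α) : Finset α :=
  {x | Maximal (fun y ↦ y ∈ S ∧ y ∈ T ∧ ∀ z ∈ S ∆ T, ¬ y ≤ z) x ∨ Maximal (· ∈ S \ T) x ∨
    Minimal (· ∈ T \ S) x ∧ ¬ Maximal (· ∈ T \ S) x}

lemma mem_antichainOfPair {S T : Finset α} {x : α} : x ∈ antichainOfPair S T ↔
    Maximal (fun y ↦ y ∈ S ∧ y ∈ T ∧ ∀ z ∈ S ∆ T, ¬ y ≤ z) x ∨ Maximal (· ∈ S \ T) x ∨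
      Minimal (· ∈ T \ S) x ∧ ¬ Maximal (· ∈ T \ S) x := by
  simp [antichainOfPair]

lemma isAntichain_antichainOfPair {S T : Finset α}
    (hS : IsLowerSet (S : Set α)) (hT : IsLowerSet (T : Set α)) :
    IsAntichain (· ≤ ·) (antichainOfPair S T : Set α) := by
  intro x hx y hy hne hle
  rw [mem_coe, mem_antichainOfPair] at hx hy
  have hX : ∀ {z}, z ∈ S \ T → z ∈ S ∆ T := fun h ↦ mem_union_left _ h
  have hY : ∀ {z}, z ∈ T \ S → z ∈ S ∆ T := fun h ↦ mem_union_right _ h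
  obtain hx | hx | hx := hx <;> obtain hy | hy | hy := hy
  · exact hne (hx.eq_of_le hy.1 hle)
  · exact hx.1.2.2 y (hX hy.1) hle
  · exact hx.1.2.2 y (hY hy.1.1) hle
  · exact (mem_sdiff.1 hx.1).2 (hT hle hy.1.2.1)
  · exact hne (hx.eq_of_le hy.1 hle)
  · exact not_le_of_mem_sdiff hT hx.1 hy.1.1 hle
  · exact (mem_sdiff.1 hx.1.1).2 (hS hle hy.1.1)
  · exact not_le_of_mem_sdiff hS hx.1.1 hy.1 hle
  · exact hne (hy.1.eq_of_le hx.1.1 hle)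

lemma mem_symmDiff_antichainOfPair_of_mem_sdiff {S T : Finset α} {x : α} (h : x ∈ S \ T) :
    x ∈ antichainOfPair S T ∆ antichainOfPair T S ↔
      Maximal (· ∈ S \ T) x ∨ Minimal (· ∈ S \ T) x := by
  have hS := (mem_sdiff.1 h).1
  have hT := (mem_sdiff.1 h).2
  have h₁ : x ∈ antichainOfPair S T ↔ Maximal (· ∈ S \ T) x := by
    rw [mem_antichainOfPair]
    refine ⟨?_, fun h ↦ .inr (.inl h)⟩
    rintro (h | h | h)
    · exact absurd h.1.2.1 hT
    · exact h
    · exact absurd (mem_sdiff.1 h.1.1).1 hT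
  have h₂ : x ∈ antichainOfPair T S ↔
      Minimal (· ∈ S \ T) x ∧ ¬ Maximal (· ∈ S \ T) x := by
    rw [mem_antichainOfPair]
    refine ⟨?_, fun h ↦ .inr (.inr h)⟩
    rintro (h | h | h)
    · exact absurd h.1.1 hT
    · exact absurd (mem_sdiff.1 h.1).1 hT
    · exact h
  rw [mem_symmDiff, h₁, h₂]
  tauto

lemma mem_symmDiff_antichainOfPair {S T : Finset α} {x : α} :
    x ∈ antichainOfPair S T ∆ antichainOfPair T S ↔
      (Maximal (· ∈ S \ T) x ∨ Minimal (· ∈ S \ T) x) ∨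
        (Maximal (· ∈ T \ S) x ∨ Minimal (· ∈ T \ S) x) := by
  constructor
  · intro h
    by_cases hxS : x ∈ S <;> by_cases hxT : x ∈ T
    · have hcomm : ∀ y, (y ∈ S ∧ y ∈ T ∧ ∀ z ∈ S ∆ T, ¬ y ≤ z) ↔
          (y ∈ T ∧ y ∈ S ∧ ∀ z ∈ T ∆ S, ¬ y ≤ z) := fun y ↦ by
        rw [symmDiff_comm]; tauto
      have hX : ¬ x ∈ S \ T := fun h ↦ (mem_sdiff.1 h).2 hxT
      have hY : ¬ x ∈ T \ S := fun h ↦ (mem_sdiff.1 h).2 hxS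
      have hS : x ∈ antichainOfPair S T ↔
          Maximal (fun y ↦ y ∈ S ∧ y ∈ T ∧ ∀ z ∈ S ∆ T, ¬ y ≤ z) x := by
        rw [mem_antichainOfPair, or_iff_left]
        rintro (h | h)
        exacts [hX h.1, hY h.1.1]
      have hT : x ∈ antichainOfPair T S ↔
          Maximal (fun y ↦ y ∈ S ∧ y ∈ T ∧ ∀ z ∈ S ∆ T, ¬ y ≤ z) x := by
        simp only [hcomm]
        rw [mem_antichainOfPair, or_iff_left]
        rintro (h | h)
        exacts [hY h.1, hX h.1.1]
      rw [mem_symmDiff, hS, hT] at h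
      tauto
    · exact .inl ((mem_symmDiff_antichainOfPair_of_mem_sdiff (mem_sdiff.2 ⟨hxS, hxT⟩)).1 h)
    · rw [symmDiff_comm] at h
      exact .inr ((mem_symmDiff_antichainOfPair_of_mem_sdiff (mem_sdiff.2 ⟨hxT, hxS⟩)).1 h)
    · rw [mem_symmDiff, mem_antichainOfPair, mem_antichainOfPair] at h
      exfalso
      simp only [Maximal, Minimal, mem_sdiff] at h
      tauto
  · rintro (h | h)
    · exact (mem_symmDiff_antichainOfPair_of_mem_sdiff (h.elim (·.1) (·.1))).2 h
    · rw [symmDiff_comm]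
      exact (mem_symmDiff_antichainOfPair_of_mem_sdiff (h.elim (·.1) (·.1))).2 h

lemma symmDiff_antichainOfPair_subset (S T : Finset α) :
    antichainOfPair S T ∆ antichainOfPair T S ⊆ S ∆ T := by
  intro x hx
  rw [mem_symmDiff_antichainOfPair] at hx
  exact mem_union.2 (hx.imp (·.elim (·.1) (·.1)) (·.elim (·.1) (·.1)))

lemma exists_mem_symmDiff_antichainOfPair_le {S T : Finset α} {x : α} (hx : x ∈ S ∆ T) :
    ∃ d ∈ antichainOfPair S T ∆ antichainOfPair T S, d ≤ x := by
  obtain hx | hx := mem_union.1 hx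
  · obtain ⟨d, hd, hmin⟩ := (S \ T).exists_le_minimal hx
    exact ⟨d, mem_symmDiff_antichainOfPair.2 (.inl (.inr hmin)), hd⟩
  · obtain ⟨d, hd, hmin⟩ := (T \ S).exists_le_minimal hx
    exact ⟨d, mem_symmDiff_antichainOfPair.2 (.inr (.inr hmin)), hd⟩

lemma antichainOfPair_subset_union (S T : Finset α) : antichainOfPair S T ⊆ S ∪ T := by
  intro x hx
  rw [mem_union]
  obtain hx | hx | hx := mem_antichainOfPair.1 hx
  exacts [.inl hx.1.1, .inl (mem_sdiff.1 hx.1).1, .inr (mem_sdiff.1 hx.1.1).1]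

/-- The downset `S` is determined by the pair of antichains assigned to `(S, T)`. -/
lemma mem_iff_antichainOfPair {S T : Finset α}
    (hS : IsLowerSet (S : Set α)) (hT : IsLowerSet (T : Set α)) (x : α) :
    x ∈ S ↔ (∃ a ∈ antichainOfPair S T ∪ antichainOfPair T S, x ≤ a) ∧
      ((∃ d ∈ antichainOfPair S T ∆ antichainOfPair T S, d ≤ x) →
        ∃ a ∈ antichainOfPair S T,
          (∀ d ∈ antichainOfPair S T ∆ antichainOfPair T S, ¬ a < d) ∧ x ≤ a) := by
  have maxX : ∀ x ∈ S \ T, ∃ a, x ≤ a ∧ Maximal (· ∈ S \ T) a :=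
    fun x hx ↦ (S \ T).exists_le_maximal hx
  have maxY : ∀ x ∈ T \ S, ∃ a, x ≤ a ∧ Maximal (· ∈ T \ S) a :=
    fun x hx ↦ (T \ S).exists_le_maximal hx
  constructor
  · intro hxS
    constructor
    · by_cases h : ∃ z ∈ S ∆ T, x ≤ z
      · obtain ⟨z, hz, hxz⟩ := h
        obtain hz | hz := mem_union.1 hz
        · obtain ⟨a, hza, ha⟩ := maxX z hz
          exact ⟨a, mem_union_left _ (mem_antichainOfPair.2 (.inr (.inl ha))), hxz.trans hza⟩
        · obtain ⟨a, hza, ha⟩ := maxY z hz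
          exact ⟨a, mem_union_right _ (mem_antichainOfPair.2 (.inr (.inl ha))), hxz.trans hza⟩
      · push Not at h
        have hxT : x ∈ T := by
          by_contra hxT
          exact h x (mem_union_left _ (mem_sdiff.2 ⟨hxS, hxT⟩)) le_rfl
        obtain ⟨a, hxa, ha⟩ := Finite.exists_le_maximal
          (p := fun y ↦ y ∈ S ∧ y ∈ T ∧ ∀ z ∈ S ∆ T, ¬ y ≤ z) ⟨hxS, hxT, h⟩
        exact ⟨a, mem_union_left _ (mem_antichainOfPair.2 (.inl ha)), hxa⟩
    · rintro ⟨d, hd, hdx⟩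
      have hxT : x ∉ T := by
        intro hxT
        have hdC := symmDiff_antichainOfPair_subset S T hd
        rw [mem_symmDiff] at hdC
        have hdS : d ∈ S := hS hdx hxS
        have hdT : d ∈ T := hT hdx hxT
        tauto
      obtain ⟨a, hxa, ha⟩ := maxX x (mem_sdiff.2 ⟨hxS, hxT⟩)
      refine ⟨a, mem_antichainOfPair.2 (.inr (.inl ha)), fun e he hae ↦ ?_, hxa⟩
      obtain he | he := mem_union.1 (symmDiff_antichainOfPair_subset S T he)
      · exact ha.not_gt he hae
      · exact not_le_of_mem_sdiff hT ha.1 he hae.le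
  · rintro ⟨⟨a, ha, hxa⟩, h⟩
    by_contra hxS
    have haST : a ∈ S ∪ T := by
      obtain ha | ha := mem_union.1 ha
      · exact antichainOfPair_subset_union S T ha
      · exact union_comm T S ▸ antichainOfPair_subset_union T S ha
    have hxT : x ∈ T := by
      obtain ha | ha := mem_union.1 haST
      exacts [absurd (hS hxa ha) hxS, hT hxa ha]
    obtain ⟨b, hb, hbmax, hxb⟩ := h (exists_mem_symmDiff_antichainOfPair_le
      (mem_union_right _ (mem_sdiff.2 ⟨hxT, hxS⟩)))
    obtain hb | hb | ⟨hb, hbn⟩ := mem_antichainOfPair.1 hb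
    · exact hxS (hS hxb hb.1.1)
    · exact hxS (hS hxb (mem_sdiff.1 hb.1).1)
    · obtain ⟨c, hbc, hc⟩ := maxY b hb.1
      refine hbmax c (mem_symmDiff_antichainOfPair.2 (.inr (.inl hc))) (hbc.lt_of_ne ?_)
      rintro rfl
      exact hbn hc

end Antichain

/-- The distributive lattice structure on downsets extending the inclusion order. -/
abbrev downFinsetDistribLattice (α : Type*) [PartialOrder α] [DecidableEq α] :
    DistribLattice (DownFinset α) :=
  Subtype.distribLattice (P := fun S : Finset α ↦ IsLowerSet (S : Set α))
    (fun _ _ hS hT ↦ by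
      rw [sup_eq_union, coe_union]
      exact hS.union hT)
    (fun _ _ hS hT ↦ by
      rw [inf_eq_inter, coe_inter]
      exact hS.inter hT)

/-- For a finite poset `P`, four times the linear extension diameter of the downset
lattice `D_P` is at most the number of ordered pairs `(A,B)` of antichains of `P` such that
`P[A ∆ B]` has at least two connected components. -/
theorem led_downset_lattice_upper {α : Type*} [Fintype α] [PartialOrder α] [DecidableEq α]
    (L₁ L₂ : DownFinset α → DownFinset α → Prop)
    (h₁ : IsLinExt L₁) (h₂ : IsLinExt L₂) :
    4 * revCount L₁ L₂ ≤
      Set.ncard {p : Finset α × Finset α |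
        IsAntichain (· ≤ ·) (↑p.1 : Set α) ∧ IsAntichain (· ≤ ·) (↑p.2 : Set α) ∧
        2 ≤ numComponents (↑(p.1 ∆ p.2) : Set α)} := by
  classical
  let := downFinsetDistribLattice α
  let Q (S T : DownFinset α) : Prop := 2 ≤ numComponents (↑(S.1 ∆ T.1) : Set α)
  have hrev := four_mul_card_reversals_le L₁ L₂ h₁.1 h₂.1 h₁.2 h₂.2 Q
    (fun S T hST hTS ↦ two_le_numComponents_iff.2
      (compGraph_symmDiff_not_preconnected S.2 T.2 hST hTS))
    (fun S T S' T' hinf hsup hQ ↦ by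
      have hinf' : S.1 ⊓ T.1 = S'.1 ⊓ T'.1 := congrArg Subtype.val hinf
      have hsup' : S.1 ⊔ T.1 = S'.1 ⊔ T'.1 := congrArg Subtype.val hsup
      have : S.1 ∆ T.1 = S'.1 ∆ T'.1 := by
        rw [symmDiff_eq_sup_sdiff_inf, hinf', hsup', ← symmDiff_eq_sup_sdiff_inf]
      simpa only [Q, this] using hQ)
  rw [revCount, Set.ncard_eq_toFinset_card', Set.toFinset_ofPred]
  refine hrev.trans ?_
  rw [Set.ncard_eq_toFinset_card', Set.toFinset_ofPred]
  refine card_le_card_of_injOn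
    (fun p ↦ (antichainOfPair p.1.1 p.2.1, antichainOfPair p.2.1 p.1.1)) ?_ ?_
  · rintro ⟨S, T⟩ hST
    simp only [coe_filter, mem_univ, true_and, Set.mem_ofPred_eq, Q] at hST ⊢
    refine ⟨isAntichain_antichainOfPair S.2 T.2, isAntichain_antichainOfPair T.2 S.2, ?_⟩
    rw [two_le_numComponents_iff] at hST ⊢
    refine fun h ↦ hST (compGraph_preconnected_of_subset ?_ (fun x hx ↦ ?_) h)
    · exact coe_subset.2 (symmDiff_antichainOfPair_subset S.1 T.1)
    · exact exists_mem_symmDiff_antichainOfPair_le hx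
  · rintro ⟨S, T⟩ - ⟨S', T'⟩ - h
    obtain ⟨hA, hB⟩ : antichainOfPair S.1 T.1 = antichainOfPair S'.1 T'.1 ∧
        antichainOfPair T.1 S.1 = antichainOfPair T'.1 S'.1 := Prod.ext_iff.1 h
    refine Prod.ext (Subtype.ext (Finset.ext fun x ↦ ?_)) (Subtype.ext (Finset.ext fun x ↦ ?_))
    · rw [mem_iff_antichainOfPair S.2 T.2, mem_iff_antichainOfPair S'.2 T'.2, hA, hB]
    · rw [mem_iff_antichainOfPair T.2 S.2, mem_iff_antichainOfPair T'.2 S'.2, hA, hB]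
end

section
/- Let P be a finite poset that admits a realizer of cardinality 2. A linear extension π of P is contained in a realizer of cardinality 2 if and only if π is non-separating. -/
open Finset
open scoped symmDiff

/-- The relation that agrees with `≤` on comparable pairs and reverses `π` on incomparable ones. -/
def conjugateOrder {α : Type*} [PartialOrder α] (π : α → α → Prop) (x y : α) : Prop :=
  x ≤ y ∨ (¬ y ≤ x ∧ π y x)

theorem conjugateOrder_trans {α : Type*} [PartialOrder α] {π : α → α → Prop}
    (hπ : IsLinExt π) (hns : NonSeparating π) {x y z : α}
    (hxy : conjugateOrder π x y) (hyz : conjugateOrder π y z) : conjugateOrder π x z := by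
  obtain ⟨hlin, hext⟩ := hπ
  have htrans : ∀ a b c, π a b → π b c → π a c := fun _ _ _ => _root_.trans
  have htotal : ∀ a b, π a b ∨ π b a := total_of π
  have hns' : ∀ u v w : α, u ≤ v → ¬ w ≤ u → ¬ u ≤ w → ¬ w ≤ v → ¬ v ≤ w →
      π u w → π w v → False := by
    intro u v w huv h₁ h₂ h₃ h₄ h₅ h₆
    refine hns ⟨u, v, w, lt_of_le_of_ne huv ?_, h₁, h₂, h₃, h₄, h₅, ?_, h₆, ?_⟩
    · rintro rfl
      exact h₂ (antisymm h₅ h₆ ▸ le_rfl)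
    · rintro rfl
      exact h₁ le_rfl
    · rintro rfl
      exact h₃ le_rfl
  by_cases hxz : x ≤ z
  · exact Or.inl hxz
  rcases hxy with hxy | ⟨hyx, pyx⟩ <;> rcases hyz with hyz | ⟨hzy, pzy⟩
  · exact absurd (hxy.trans hyz) hxz
  · by_cases hyz : y ≤ z
    · exact absurd (hxy.trans hyz) hxz
    refine Or.inr ⟨fun h => hzy (h.trans hxy), ?_⟩
    rcases htotal z x with h | h
    · exact h
    · exact (hns' x y z hxy (fun h => hzy (h.trans hxy)) hxz hzy hyz h pzy).elim
  · by_cases hxy : x ≤ y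
    · exact absurd (hxy.trans hyz) hxz
    refine Or.inr ⟨fun h => hyx (hyz.trans h), ?_⟩
    rcases htotal z x with h | h
    · exact h
    · exact (hns' y z x hyz hxy hyx hxz (fun h => hyx (hyz.trans h)) pyx h).elim
  · refine Or.inr ⟨fun hzx => ?_, htrans _ _ _ pzy pyx⟩
    by_cases hxy : x ≤ y
    · exact hzy (hzx.trans hxy)
    by_cases hyz : y ≤ z
    · exact hyx (hyz.trans hzx)
    exact hns' z x y hzx hyz hzy hyx hxy pzy pyx

theorem isLinExt_conjugateOrder {α : Type*} [PartialOrder α] {π : α → α → Prop}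
    (hπ : IsLinExt π) (hns : NonSeparating π) : IsLinExt (conjugateOrder π) := by
  have hlin := hπ.1
  have hrefl : Std.Refl (conjugateOrder π) := ⟨fun _ => Or.inl le_rfl⟩
  have htrans : IsTrans α (conjugateOrder π) :=
    ⟨fun _ _ _ h h' => conjugateOrder_trans hπ hns h h'⟩
  have hantisymm : Std.Antisymm (conjugateOrder π) := by
    refine ⟨fun x y hxy hyx => ?_⟩
    rcases hxy with hxy | ⟨nyx, pyx⟩ <;> rcases hyx with hyx | ⟨nxy, pxy⟩
    · exact le_antisymm hxy hyx
    · exact absurd hxy nxy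
    · exact absurd hyx nyx
    · exact antisymm pxy pyx
  have htotal : Std.Total (conjugateOrder π) := by
    refine ⟨fun x y => ?_⟩
    by_cases hxy : x ≤ y
    · exact Or.inl (Or.inl hxy)
    by_cases hyx : y ≤ x
    · exact Or.inr (Or.inl hyx)
    rcases total_of π x y with h | h
    · exact Or.inr (Or.inr ⟨hxy, h⟩)
    · exact Or.inl (Or.inr ⟨hyx, h⟩)
  exact ⟨{ }, fun _ _ => Or.inl⟩

theorem isRealizer2_conjugateOrder {α : Type*} [PartialOrder α] {π : α → α → Prop}
    (hπ : IsLinExt π) (hns : NonSeparating π) : IsRealizer2 π (conjugateOrder π) := by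
  have hlin := hπ.1
  refine ⟨hπ, isLinExt_conjugateOrder hπ hns, fun x y => ⟨fun h => ⟨hπ.2 x y h, Or.inl h⟩, ?_⟩⟩
  rintro ⟨pxy, h | ⟨-, pyx⟩⟩
  · exact h
  · exact (antisymm pxy pyx : x = y).le

theorem IsRealizer2.nonSeparating {α : Type*} [PartialOrder α] {π ρ : α → α → Prop}
    (h : IsRealizer2 π ρ) : NonSeparating π := by
  obtain ⟨-, ⟨hlin, hext⟩, hle⟩ := h
  rintro ⟨u, v, x, huv, -, hux, hxv, -, pux, -, pxv, -⟩
  have hxu : ρ x u :=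
    (total_of ρ u x).resolve_left fun h => hux ((hle u x).2 ⟨pux, h⟩)
  exact hxv ((hle x v).2 ⟨pxv, _root_.trans hxu (hext u v huv.le)⟩)

/-- For a finite poset admitting a realizer of cardinality 2, a linear extension π
is contained in a realizer of cardinality 2 iff π is non-separating. -/
theorem nonseparating_iff_in_realizer {α : Type*} [Fintype α] [PartialOrder α]
    (h2dim : ∃ τ τ' : α → α → Prop, IsRealizer2 τ τ')
    (π : α → α → Prop) (hπ : IsLinExt π) :
    (∃ ρ : α → α → Prop, IsRealizer2 π ρ) ↔ NonSeparating π := by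
  exact ⟨fun ⟨_, h⟩ => h.nonSeparating,
    fun hns => ⟨conjugateOrder π, isRealizer2_conjugateOrder hπ hns⟩⟩
end
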